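/- arXiv:1204.0329 — 4 statements merged into one kernel-verified Lean document; each statement's English description precedes it below -/
import Mathlib

section
/- Let n ≥ 2, let x, y ∈ ℝ^n with x ≠ y, and let r ∈ (0,1). Then the union over all s > 0 of the open balls D^r_{x, x+s(y−x)} equals { a ∈ ℝ^n : a ≠ x, ∠(a,x,y) < arcsin r }, where ∠(a,x,y) denotes the Euclidean angle at the vertex x between the vectors a−x and y−x. -/
section InnerProductSpace

variable {V : Type*} [NormedAddCommGroup V] [InnerProductSpace ℝ V]

/-- The angle between two nonzero vectors is smaller than `arcsin r` exactly when their inner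
product exceeds `√(1 - r ^ 2)` times the product of their norms. -/
theorem InnerProductGeometry.angle_lt_arcsin_iff {u v : V} (hu : u ≠ 0) (hv : v ≠ 0)
    {r : ℝ} (hr : 0 ≤ r) :
    InnerProductGeometry.angle u v < Real.arcsin r ↔
      √(1 - r ^ 2) * (‖u‖ * ‖v‖) < inner ℝ u v := by
  have hpos : 0 < ‖u‖ * ‖v‖ := mul_pos (norm_pos_iff.2 hu) (norm_pos_iff.2 hv)
  rw [← InnerProductGeometry.cos_angle_mul_norm_mul_norm u v, mul_lt_mul_iff_left₀ hpos,
    ← Real.cos_arcsin]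
  refine (Real.strictAntiOn_cos.lt_iff_gt ?_ ?_).symm
  · exact ⟨Real.arcsin_nonneg.2 hr,
      (Real.arcsin_le_pi_div_two r).trans (half_le_self Real.pi_pos.le)⟩
  · exact ⟨InnerProductGeometry.angle_nonneg u v, InnerProductGeometry.angle_le_pi u v⟩

/-- The open ray spanned by `v` meets the ball of radius `r * ‖u‖` about `u` exactly when the
inner product of `u` and `v` exceeds `√(1 - r ^ 2) * (‖u‖ * ‖v‖)`. -/
theorem exists_pos_norm_smul_sub_lt_iff {u v : V} (hv : v ≠ 0) {r : ℝ} (hr₀ : 0 ≤ r)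
    (hr₁ : r ≤ 1) :
    (∃ s : ℝ, 0 < s ∧ ‖s • v - u‖ < r * ‖u‖) ↔
      √(1 - r ^ 2) * (‖u‖ * ‖v‖) < inner ℝ u v := by
  have hv' : 0 < ‖v‖ := norm_pos_iff.2 hv
  have hc : √(1 - r ^ 2) ^ 2 = 1 - r ^ 2 := Real.sq_sqrt (by nlinarith)
  have hc₀ : 0 ≤ √(1 - r ^ 2) := Real.sqrt_nonneg _
  set c := √(1 - r ^ 2)
  have key (s : ℝ) : ‖s • v - u‖ < r * ‖u‖ ↔
      s ^ 2 * ‖v‖ ^ 2 + c ^ 2 * ‖u‖ ^ 2 < 2 * s * inner ℝ u v := by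
    rw [← sq_lt_sq₀ (norm_nonneg _) (by positivity), norm_sub_sq_real, norm_smul, mul_pow,
      Real.norm_eq_abs, sq_abs, real_inner_smul_left, real_inner_comm, hc]
    constructor <;> intro h <;> linarith
  simp only [key]
  constructor
  · rintro ⟨s, hs, h⟩
    refine lt_of_mul_lt_mul_left ?_ hs.le
    linarith [sq_nonneg (s * ‖v‖ - c * ‖u‖)]
  · intro h
    have hI : 0 < inner ℝ u v := lt_of_le_of_lt (by positivity) h
    refine ⟨inner ℝ u v / ‖v‖ ^ 2, by positivity, ?_⟩
    have hsq : (c * (‖u‖ * ‖v‖)) ^ 2 < (inner ℝ u v) ^ 2 :=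
      pow_lt_pow_left₀ h (by positivity) two_ne_zero
    refine lt_of_mul_lt_mul_right ?_ (sq_nonneg ‖v‖)
    field_simp
    linarith

end InnerProductSpace

/-- Let `x ≠ y` in `ℝⁿ` (`n ≥ 2`) and `r ∈ (0,1)`. The union over all `s > 0` of the
open Apollonian balls `D^r_{x, x+s(y−x)} = {w : |x+s(y−x)−w| < r|x−w|}` is the open
angular cone `{a ≠ x : ∠(a,x,y) < arcsin r}` with vertex `x` and axis towards `y`. -/
theorem apollonian_balls_union_angular_domain
    (n : ℕ) (hn : 2 ≤ n) (x y : EuclideanSpace ℝ (Fin n)) (hxy : x ≠ y)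
    (r : ℝ) (hr : r ∈ Set.Ioo (0 : ℝ) 1) :
    (⋃ s ∈ Set.Ioi (0 : ℝ),
        {w : EuclideanSpace ℝ (Fin n) | dist (x + s • (y - x)) w < r * dist x w}) =
      {a : EuclideanSpace ℝ (Fin n) | a ≠ x ∧
        EuclideanGeometry.angle a x y < Real.arcsin r} := by
  have hv : y - x ≠ 0 := sub_ne_zero.2 hxy.symm
  ext w
  have hdist (s : ℝ) : dist (x + s • (y - x)) w < r * dist x w ↔
      ‖s • (y - x) - (w - x)‖ < r * ‖w - x‖ := by
    rw [dist_eq_norm, dist_comm x w, dist_eq_norm, sub_sub_eq_add_sub, add_comm x]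
  simp only [Set.mem_iUnion, Set.mem_Ioi, Set.mem_ofPred_eq, exists_prop, hdist,
    exists_pos_norm_smul_sub_lt_iff hv hr.1.le hr.2.le]
  rcases eq_or_ne w x with rfl | hw
  · simp
  · rw [EuclideanGeometry.angle, vsub_eq_sub, vsub_eq_sub,
      InnerProductGeometry.angle_lt_arcsin_iff (sub_ne_zero.2 hw) hv hr.1.le]
    simp [hw]
end

section
/- Let n ≥ 2, let y, z ∈ ℝ^n with y ≠ z, let G = ℝ^n \ {y, z}, x ∈ G and r > 0. Then the complement ℝ^n \ B_α(x,r) is not connected; indeed it is the union of the two nonempty, disjoint closed sets { w ∈ ℝ^n : e^r |x−z| |w−y| ≤ |x−y| |w−z| } and { w ∈ ℝ^n : e^r |x−y| |w−z| ≤ |x−z| |w−y| }. -/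
/-- The Apollonian distance in the twice punctured space `ℝⁿ \ {y, z}`:
the maximum over boundary points `a, b ∈ {y, z}` of
`log (|a−w||x−b| / (|a−x||w−b|))`. -/
noncomputable def apoTwice {n : ℕ} (y z x w : EuclideanSpace ℝ (Fin n)) : ℝ :=
  max
    (max (Real.log (dist y w * dist x y / (dist y x * dist w y)))
         (Real.log (dist y w * dist x z / (dist y x * dist w z))))
    (max (Real.log (dist z w * dist x y / (dist z x * dist w y)))
         (Real.log (dist z w * dist x z / (dist z x * dist w z))))

theorem not_isConnected_union_of_isClosed {X : Type*} [TopologicalSpace X] {s t : Set X}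
    (hs : IsClosed s) (ht : IsClosed t) (hs' : s.Nonempty) (ht' : t.Nonempty)
    (hst : Disjoint s t) : ¬ IsConnected (s ∪ t) := by
  intro h
  obtain ⟨w, -, hws, hwt⟩ := isPreconnected_closed_iff.1 h.isPreconnected s t hs ht subset_rfl
    (hs'.mono fun w hw => ⟨Or.inl hw, hw⟩) (ht'.mono fun w hw => ⟨Or.inr hw, hw⟩)
  exact Set.disjoint_left.1 hst hws hwt

theorem apoTwice_lt_iff {n : ℕ} {y z x w : EuclideanSpace ℝ (Fin n)} {r : ℝ}
    (hxy : x ≠ y) (hxz : x ≠ z) (hwy : w ≠ y) (hwz : w ≠ z) (hr : 0 < r) :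
    apoTwice y z x w < r ↔
      dist x y * dist w z < Real.exp r * dist x z * dist w y ∧
        dist x z * dist w y < Real.exp r * dist x y * dist w z := by
  have hxy := dist_pos.2 hxy
  have hxz := dist_pos.2 hxz
  have hwy := dist_pos.2 hwy
  have hwz := dist_pos.2 hwz
  have log_self (a b : ℝ) (ha : 0 < a) (hb : 0 < b) : Real.log (a * b / (b * a)) < r := by
    rwa [mul_comm b a, div_self (by positivity), Real.log_one]
  have log_cross (a b c d : ℝ) (ha : 0 < a) (hb : 0 < b) (hc : 0 < c) (hd : 0 < d) :
      Real.log (a * b / (c * d)) < r ↔ b * a < Real.exp r * c * d := by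
    rw [Real.log_lt_iff_lt_exp (by positivity), div_lt_iff₀ (by positivity), mul_comm a b,
      mul_assoc]
  rw [apoTwice, dist_comm y w, dist_comm y x, dist_comm z w, dist_comm z x]
  simp only [max_lt_iff, log_self _ _ hwy hxy, log_self _ _ hwz hxz,
    log_cross _ _ _ _ hwy hxz hxy hwz, log_cross _ _ _ _ hwz hxy hxz hwy, true_and, and_true]
  exact and_comm

/-- In `G = ℝⁿ \ {y, z}` (`y ≠ z`, `n ≥ 2`), for `x ∈ G` and `r > 0`, the complement
of the Apollonian ball `B_α(x,r)` is disconnected: it is the union of the two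
nonempty, disjoint closed sets `{w : eʳ|x−z||w−y| ≤ |x−y||w−z|}` and
`{w : eʳ|x−y||w−z| ≤ |x−z||w−y|}`. -/
theorem apollonian_ball_twice_punctured_complement_disconnected
    (n : ℕ) (hn : 2 ≤ n) (y z : EuclideanSpace ℝ (Fin n)) (hyz : y ≠ z)
    (x : EuclideanSpace ℝ (Fin n)) (hx : x ≠ y ∧ x ≠ z) (r : ℝ) (hr : 0 < r) :
    ¬ IsConnected ({w : EuclideanSpace ℝ (Fin n) |
        (w ≠ y ∧ w ≠ z) ∧ apoTwice y z x w < r}ᶜ) ∧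
    {w : EuclideanSpace ℝ (Fin n) | (w ≠ y ∧ w ≠ z) ∧ apoTwice y z x w < r}ᶜ =
      {w : EuclideanSpace ℝ (Fin n) |
          Real.exp r * dist x z * dist w y ≤ dist x y * dist w z} ∪
        {w : EuclideanSpace ℝ (Fin n) |
          Real.exp r * dist x y * dist w z ≤ dist x z * dist w y} ∧
    {w : EuclideanSpace ℝ (Fin n) |
        Real.exp r * dist x z * dist w y ≤ dist x y * dist w z}.Nonempty ∧
    {w : EuclideanSpace ℝ (Fin n) |
        Real.exp r * dist x y * dist w z ≤ dist x z * dist w y}.Nonempty ∧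
    Disjoint
      {w : EuclideanSpace ℝ (Fin n) |
        Real.exp r * dist x z * dist w y ≤ dist x y * dist w z}
      {w : EuclideanSpace ℝ (Fin n) |
        Real.exp r * dist x y * dist w z ≤ dist x z * dist w y} ∧
    IsClosed {w : EuclideanSpace ℝ (Fin n) |
        Real.exp r * dist x z * dist w y ≤ dist x y * dist w z} ∧
    IsClosed {w : EuclideanSpace ℝ (Fin n) |
        Real.exp r * dist x y * dist w z ≤ dist x z * dist w y} := by
  obtain ⟨hxy, hxz⟩ := hx
  have hxy_pos := dist_pos.2 hxy
  have hxz_pos := dist_pos.2 hxz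
  set S := {w : EuclideanSpace ℝ (Fin n) |
    Real.exp r * dist x z * dist w y ≤ dist x y * dist w z} with hS
  set T := {w : EuclideanSpace ℝ (Fin n) |
    Real.exp r * dist x y * dist w z ≤ dist x z * dist w y} with hT
  have hyS : y ∈ S := by
    simp only [hS, Set.mem_ofPred_eq, dist_self, mul_zero]
    positivity
  have hzT : z ∈ T := by
    simp only [hT, Set.mem_ofPred_eq, dist_self, mul_zero]
    positivity
  have hS_closed : IsClosed S := isClosed_le (by fun_prop) (by fun_prop)
  have hT_closed : IsClosed T := isClosed_le (by fun_prop) (by fun_prop)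
  have hdisj : Disjoint S T := by
    refine Set.disjoint_left.2 fun w hwS hwT => ?_
    simp only [hS, hT, Set.mem_ofPred_eq, mul_assoc] at hwS hwT
    have hexp : 1 < Real.exp r := Real.one_lt_exp_iff.2 hr
    have hA : 0 ≤ dist x z * dist w y := by positivity
    have hB : 0 ≤ dist x y * dist w z := by positivity
    have hA0 : dist x z * dist w y = 0 := by nlinarith
    have hB0 : dist x y * dist w z = 0 := by nlinarith
    exact hyz ((dist_eq_zero.1 ((mul_eq_zero.1 hA0).resolve_left hxz_pos.ne')).symm.trans
      (dist_eq_zero.1 ((mul_eq_zero.1 hB0).resolve_left hxy_pos.ne')))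
  have hunion : {w : EuclideanSpace ℝ (Fin n) |
      (w ≠ y ∧ w ≠ z) ∧ apoTwice y z x w < r}ᶜ = S ∪ T := by
    ext w
    by_cases hwy : w = y
    · subst hwy
      simp [hyS]
    by_cases hwz : w = z
    · subst hwz
      simp [hzT]
    simp only [Set.mem_compl_iff, Set.mem_ofPred_eq, Set.mem_union, hS, hT, ne_eq, hwy, hwz,
      not_false_eq_true, true_and, apoTwice_lt_iff hxy hxz hwy hwz hr, not_and_or, not_lt]
  refine ⟨?_, hunion, ⟨y, hyS⟩, ⟨z, hzT⟩, hdisj, hS_closed, hT_closed⟩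
  rw [hunion]
  exact not_isConnected_union_of_isClosed hS_closed hT_closed ⟨y, hyS⟩ ⟨z, hzT⟩ hdisj
end

section
/- Let n ≥ 2, let y, z ∈ ℝ^n with y ≠ z, let G = ℝ^n \ {y, z}, x ∈ G, and let r_1 = log(1 + |y−z| / max{|x−y|, |x−z|}). Then for every r with 0 < r ≤ r_1 the ball B_δ(x,r) is convex. -/
/-- Seittenranta's distance in the twice punctured space `ℝⁿ \ {y, z}`:
the maximum over boundary points `a, b ∈ {y, z}` of
`log (1 + |a−b||x−w| / (|a−x||w−b|))`. -/
noncomputable def seitTwice {n : ℕ} (y z x w : EuclideanSpace ℝ (Fin n)) : ℝ :=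
  max
    (max (Real.log (1 + dist y y * dist x w / (dist y x * dist w y)))
         (Real.log (1 + dist y z * dist x w / (dist y x * dist w z))))
    (max (Real.log (1 + dist z y * dist x w / (dist z x * dist w y)))
         (Real.log (1 + dist z z * dist x w / (dist z x * dist w z))))

/-- The Stewart identity for a point of a segment. -/
theorem norm_sub_combo_sq {E : Type*} [NormedAddCommGroup E] [InnerProductSpace ℝ E]
    (p u v : E) {a b : ℝ} (hab : a + b = 1) :
    ‖p - (a • u + b • v)‖ ^ 2 =
      a * ‖p - u‖ ^ 2 + b * ‖p - v‖ ^ 2 - a * b * ‖u - v‖ ^ 2 := by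
  have h₁ : p - (a • u + b • v) = a • (p - u) + b • (p - v) := by
    nth_rewrite 1 [← one_smul ℝ p]
    rw [← hab]
    module
  have h₂ : u - v = (p - v) - (p - u) := by abel
  obtain rfl : b = 1 - a := by linarith
  rw [h₁, h₂, norm_add_sq_real, norm_sub_sq_real (p - v), norm_smul, norm_smul,
    real_inner_smul_left, real_inner_smul_right, real_inner_comm, mul_pow, mul_pow,
    Real.norm_eq_abs, Real.norm_eq_abs, sq_abs, sq_abs]
  ring

/-- The side of an Apollonian sphere with ratio at most one that contains `x` is convex. -/
theorem convex_setOf_dist_lt_mul_dist {E : Type*} [NormedAddCommGroup E]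
    [InnerProductSpace ℝ E] (x z : E) {c : ℝ} (hc₀ : 0 ≤ c) (hc₁ : c ≤ 1) :
    Convex ℝ {w : E | dist x w < c * dist z w} := by
  have hset : {w : E | dist x w < c * dist z w} =
      {w : E | ‖x - w‖ ^ 2 - c ^ 2 * ‖z - w‖ ^ 2 < 0} := by
    ext w
    rw [Set.mem_ofPred_eq, Set.mem_ofPred_eq, sub_neg, ← mul_pow, dist_eq_norm, dist_eq_norm]
    exact (pow_lt_pow_iff_left₀ (norm_nonneg _) (by positivity) two_ne_zero).symm
  rw [hset]
  intro u hu v hv a b ha hb hab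
  rw [Set.mem_ofPred_eq] at hu hv ⊢
  rw [norm_sub_combo_sq x u v hab, norm_sub_combo_sq z u v hab]
  have hc : c ^ 2 ≤ 1 := pow_le_one₀ hc₀ hc₁
  have hgap : 0 ≤ (1 - c ^ 2) * (a * b * ‖u - v‖ ^ 2) :=
    mul_nonneg (sub_nonneg.2 hc) (by positivity)
  have hcombo : a * (‖x - u‖ ^ 2 - c ^ 2 * ‖z - u‖ ^ 2)
      + b * (‖x - v‖ ^ 2 - c ^ 2 * ‖z - v‖ ^ 2) < 0 :=
    convex_Iio (𝕜 := ℝ) (0 : ℝ) hu hv ha hb hab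
  linarith

theorem log_one_add_div_lt_iff {d s p q r : ℝ} (hd : 0 < d) (hs : 0 ≤ s) (hp : 0 < p)
    (hq : 0 < q) :
    Real.log (1 + d * s / (p * q)) < r ↔ s < (Real.exp r - 1) * p / d * q := by
  rw [Real.log_lt_iff_lt_exp (by positivity), ← lt_sub_iff_add_lt', div_lt_iff₀ (by positivity),
    div_mul_eq_mul_div, lt_div_iff₀ hd, mul_comm d s, mul_assoc]

/-- A Seittenranta ball of `ℝⁿ \ {y, z}` is the intersection of two Apollonian domains. -/
theorem setOf_seitTwice_lt {n : ℕ} {y z x : EuclideanSpace ℝ (Fin n)} (hyz : y ≠ z)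
    (hxy : x ≠ y) (hxz : x ≠ z) {r : ℝ} (hr : 0 < r) :
    {w : EuclideanSpace ℝ (Fin n) | (w ≠ y ∧ w ≠ z) ∧ seitTwice y z x w < r} =
      {w | dist x w < (Real.exp r - 1) * dist x y / dist y z * dist z w} ∩
      {w | dist x w < (Real.exp r - 1) * dist x z / dist y z * dist y w} := by
  ext w
  have key (hwy : w ≠ y) (hwz : w ≠ z) : seitTwice y z x w < r ↔
      dist x w < (Real.exp r - 1) * dist x y / dist y z * dist z w ∧
      dist x w < (Real.exp r - 1) * dist x z / dist y z * dist y w := by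
    simp only [seitTwice, dist_self, zero_mul, zero_div, add_zero, Real.log_one, max_lt_iff, hr,
      true_and, and_true]
    rw [dist_comm z y, dist_comm y x, dist_comm z x, dist_comm w z, dist_comm w y]
    exact and_congr
      (log_one_add_div_lt_iff (dist_pos.2 hyz) dist_nonneg (dist_pos.2 hxy)
        (dist_pos.2 hwz.symm))
      (log_one_add_div_lt_iff (dist_pos.2 hyz) dist_nonneg (dist_pos.2 hxz)
        (dist_pos.2 hwy.symm))
  simp only [Set.mem_ofPred_eq, Set.mem_inter_iff]
  refine ⟨fun h ↦ (key h.1.1 h.1.2).1 h.2, fun h ↦ ?_⟩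
  have hwy : w ≠ y := by
    rintro rfl
    exact absurd h.2 (by simp)
  have hwz : w ≠ z := by
    rintro rfl
    exact absurd h.1 (by simp)
  exact ⟨⟨hwy, hwz⟩, (key hwy hwz).2 h⟩

/-- In `G = ℝⁿ \ {y, z}` (`y ≠ z`, `n ≥ 2`), for `x ∈ G` and
`r₁ = log (1 + |y−z| / max (|x−y|, |x−z|))`, the Seittenranta ball `B_δ(x,r)` is
convex for every `0 < r ≤ r₁`. -/
theorem seittenranta_ball_twice_punctured_convex
    (n : ℕ) (hn : 2 ≤ n) (y z : EuclideanSpace ℝ (Fin n)) (hyz : y ≠ z)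
    (x : EuclideanSpace ℝ (Fin n)) (hx : x ≠ y ∧ x ≠ z) (r : ℝ) (hr : 0 < r)
    (hr1 : r ≤ Real.log (1 + dist y z / max (dist x y) (dist x z))) :
    Convex ℝ {w : EuclideanSpace ℝ (Fin n) |
      (w ≠ y ∧ w ≠ z) ∧ seitTwice y z x w < r} := by
  obtain ⟨hxy, hxz⟩ := hx
  have hyz₀ : 0 < dist y z := dist_pos.2 hyz
  have hmax : 0 < max (dist x y) (dist x z) := lt_max_of_lt_left (dist_pos.2 hxy)
  have ht₀ : 0 ≤ Real.exp r - 1 := sub_nonneg.2 (Real.one_le_exp hr.le)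
  have ht : (Real.exp r - 1) * max (dist x y) (dist x z) ≤ dist y z := by
    rwa [Real.le_log_iff_exp_le (by positivity), ← sub_le_iff_le_add', le_div_iff₀ hmax] at hr1
  have hratio {s : ℝ} (hs : s ≤ max (dist x y) (dist x z)) :
      (Real.exp r - 1) * s / dist y z ≤ 1 :=
    (div_le_one hyz₀).2 ((mul_le_mul_of_nonneg_left hs ht₀).trans ht)
  rw [setOf_seitTwice_lt hyz hxy hxz hr]
  exact (convex_setOf_dist_lt_mul_dist x z (by positivity) (hratio (le_max_left _ _))).inter
    (convex_setOf_dist_lt_mul_dist x y (by positivity) (hratio (le_max_right _ _)))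
end

section
/- Let n ≥ 2, let y, z ∈ ℝ^n with y ≠ z, let G = ℝ^n \ {y, z}, x ∈ G, and let r_1 = log(1 + |y−z| / max{|x−y|, |x−z|}). Then for every r > r_1 the ball B_δ(x,r) is not convex. -/
open scoped RealInnerProductSpace

/-- If an open set contains one of the two points where the boundary of the Apollonian ball
`{w | t * dist w y ≤ dist x w}`, `1 < t`, meets the line `xy`, then the part of this open set
outside the ball is not convex. -/
theorem not_convex_inter_of_apollonian {E : Type*} [NormedAddCommGroup E] [InnerProductSpace ℝ E]
    {x y v : E} {U : Set E} {t k : ℝ} (ht : 1 < t) (hk : k ^ 2 = t ^ 2 * (k - 1) ^ 2)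
    (hv : v ≠ 0) (hvxy : ⟪y - x, v⟫ = 0) (hU : IsOpen U) (hp : x + k • (y - x) ∈ U) :
    ¬ Convex ℝ ({w | dist x w < t * dist w y} ∩ U) := by
  intro hC
  set p := x + k • (y - x) with hpdef
  have hnorm : ∀ a ε : ℝ, ‖a • (y - x) + ε • v‖ ^ 2 =
      a ^ 2 * ‖y - x‖ ^ 2 + ε ^ 2 * ‖v‖ ^ 2 := by
    intro a ε
    rw [norm_add_sq_real, norm_smul, norm_smul, mul_pow, mul_pow, inner_smul_left,
      inner_smul_right, hvxy]
    simp
  have hx : ∀ ε : ℝ, dist x (p + ε • v) ^ 2 = k ^ 2 * ‖y - x‖ ^ 2 + ε ^ 2 * ‖v‖ ^ 2 := by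
    intro ε
    rw [dist_comm, dist_eq_norm, ← hnorm, hpdef]
    congr 2
    module
  have hy : ∀ ε : ℝ, dist (p + ε • v) y ^ 2 =
      (k - 1) ^ 2 * ‖y - x‖ ^ 2 + ε ^ 2 * ‖v‖ ^ 2 := by
    intro ε
    rw [dist_eq_norm, ← hnorm, hpdef]
    congr 2
    module
  have hv' : 0 < ‖v‖ ^ 2 := by positivity
  have ht2 : 1 < t ^ 2 := by nlinarith
  have hmem : ∀ ε : ℝ, ε ≠ 0 → dist x (p + ε • v) < t * dist (p + ε • v) y := by
    intro ε hε
    refine lt_of_pow_lt_pow_left₀ 2 (by positivity) ?_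
    rw [mul_pow, hx, hy, hk]
    have : 0 < ε ^ 2 * ‖v‖ ^ 2 := by positivity
    nlinarith
  have hnear : ∀ᶠ ε : ℝ in nhds 0, p + ε • v ∈ U := by
    have hc : Continuous fun ε : ℝ => p + ε • v := by fun_prop
    exact hc.continuousAt.eventually_mem (hU.mem_nhds (by simpa using hp))
  obtain ⟨δ, hδ, hball⟩ := Metric.eventually_nhds_iff.mp hnear
  have hpos : p + (δ / 2) • v ∈ U := hball (by
    rw [Real.dist_eq, sub_zero, abs_of_pos (by positivity)]; linarith)
  have hneg : p + (-(δ / 2)) • v ∈ U := hball (by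
    rw [Real.dist_eq, sub_zero, abs_neg, abs_of_pos (by positivity)]; linarith)
  have hmid := hC ⟨hmem (δ / 2) (by positivity), hpos⟩
    ⟨hmem (-(δ / 2)) (by simp [hδ.ne']), hneg⟩
    (show (0 : ℝ) ≤ 1 / 2 by norm_num) (show (0 : ℝ) ≤ 1 / 2 by norm_num) (by norm_num)
  have hmid_eq : (1 / 2 : ℝ) • (p + (δ / 2) • v) + (1 / 2 : ℝ) • (p + (-(δ / 2)) • v) = p := by
    module
  rw [hmid_eq] at hmid
  have hlt : dist x p ^ 2 < (t * dist p y) ^ 2 := pow_lt_pow_left₀ hmid.1 dist_nonneg two_ne_zero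
  have h0x := hx 0
  have h0y := hy 0
  rw [zero_smul, add_zero] at h0x h0y
  rw [mul_pow, h0x, h0y, hk] at hlt
  linarith

/-- The intersection of the two Apollonian domains of `x, y` and `x, z` with ratios proportional
to `dist x z` and `dist x y` is not convex when the first ratio exceeds `1`. -/
theorem not_convex_apollonian_inter {E : Type*} [NormedAddCommGroup E] [InnerProductSpace ℝ E]
    {x y z v : E} {s t : ℝ} (ht : 1 < t) (hst : s * dist x z = t * dist x y)
    (hxy : x ≠ y) (hxz : x ≠ z) (hyz : y ≠ z) (hv : v ≠ 0) (hvxy : ⟪y - x, v⟫ = 0) :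
    ¬ Convex ℝ ({w | dist x w < t * dist w y} ∩ {w | dist x w < s * dist w z}) := by
  have hA : 0 < dist x y := dist_pos.mpr hxy
  have hB : 0 < dist x z := dist_pos.mpr hxz
  have hs : 0 < s := by
    have : 0 < s * dist x z := hst ▸ by positivity
    exact (pos_iff_pos_of_mul_pos this).mpr hB
  have hU : IsOpen {w : E | dist x w < s * dist w z} :=
    isOpen_lt (by fun_prop) (by fun_prop)
  have hsz : s ^ 2 * ‖z - x‖ ^ 2 = t ^ 2 * ‖y - x‖ ^ 2 := by
    rw [← dist_eq_norm, ← dist_eq_norm, dist_comm z, dist_comm y, ← mul_pow, ← mul_pow, hst]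
  have hd : 0 < ‖y - x‖ ^ 2 - 2 * ⟪y - x, z - x⟫ + ‖z - x‖ ^ 2 := by
    rw [← norm_sub_sq_real, sub_sub_sub_cancel_right]
    have := norm_pos_iff.mpr (sub_ne_zero.mpr hyz)
    positivity
  have hmem : ∀ k : ℝ, k ^ 2 * ‖y - x‖ ^ 2 <
      s ^ 2 * (k ^ 2 * ‖y - x‖ ^ 2 - 2 * k * ⟪y - x, z - x⟫ + ‖z - x‖ ^ 2) →
      x + k • (y - x) ∈ {w : E | dist x w < s * dist w z} := by
    intro k h
    rw [Set.mem_ofPred_eq]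
    refine lt_of_pow_lt_pow_left₀ 2 (by positivity) ?_
    have e1 : dist x (x + k • (y - x)) ^ 2 = k ^ 2 * ‖y - x‖ ^ 2 := by
      simp [mul_pow, norm_smul]
    have e2 : dist (x + k • (y - x)) z ^ 2 =
        k ^ 2 * ‖y - x‖ ^ 2 - 2 * k * ⟪y - x, z - x⟫ + ‖z - x‖ ^ 2 := by
      rw [dist_eq_norm, show x + k • (y - x) - z = k • (y - x) - (z - x) by abel,
        norm_sub_sq_real, norm_smul, mul_pow, inner_smul_left]
      simp [mul_assoc]
    rwa [mul_pow, e1, e2]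
  have hsol : ∃ σ : ℝ, σ ^ 2 = 1 ∧
      0 < (t + 2 * σ) * ‖z - x‖ ^ 2 - 2 * (t + σ) * ⟪y - x, z - x⟫ + t * ‖y - x‖ ^ 2 := by
    by_contra! h
    have h1 := h 1 (by norm_num)
    have h2 := h (-1) (by norm_num)
    nlinarith [mul_pos (zero_lt_one.trans ht) hd]
  obtain ⟨σ, hσ, hlt⟩ := hsol
  have htσ : t + σ ≠ 0 := by
    intro h
    nlinarith
  refine not_convex_inter_of_apollonian (k := t / (t + σ)) ht ?_ hv hvxy hU (hmem _ ?_)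
  · field_simp
    linear_combination -hσ
  · have hfac : 0 < s ^ 2 * t / (t + σ) ^ 2 := by positivity
    have hprod := mul_pos hfac hlt
    rw [← sub_pos]
    refine hprod.trans_eq ?_
    field_simp
    linear_combination -hsz - s ^ 2 * ‖z - x‖ ^ 2 * hσ

theorem exists_ne_zero_inner_eq_zero_of_two_le {n : ℕ} (hn : 2 ≤ n)
    (u : EuclideanSpace ℝ (Fin n)) : ∃ v : EuclideanSpace ℝ (Fin n), v ≠ 0 ∧ ⟪u, v⟫ = 0 := by
  have hsum := (ℝ ∙ u).finrank_add_finrank_orthogonal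
  have hspan := finrank_span_le_card (R := ℝ) ({u} : Set (EuclideanSpace ℝ (Fin n)))
  rw [finrank_euclideanSpace_fin] at hsum
  rw [Set.toFinset_singleton, Finset.card_singleton] at hspan
  have hne : (ℝ ∙ u)ᗮ ≠ ⊥ := fun h => by
    rw [h, finrank_bot] at hsum
    omega
  obtain ⟨v, hv, hv0⟩ := Submodule.exists_mem_ne_zero_of_ne_bot hne
  exact ⟨v, hv0, Submodule.mem_orthogonal_singleton_iff_inner_right.mp hv⟩

theorem seitTwice_comm {n : ℕ} (y z x w : EuclideanSpace ℝ (Fin n)) :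
    seitTwice y z x w = seitTwice z y x w := by
  unfold seitTwice
  rw [max_comm, max_comm (Real.log (1 + dist z y * _ / _)),
    max_comm (Real.log (1 + dist y y * _ / _))]

theorem seitTwice_ball_eq {n : ℕ} {x y z : EuclideanSpace ℝ (Fin n)} (hyz : y ≠ z)
    (hxy : x ≠ y) (hxz : x ≠ z) {r : ℝ} (hr : 0 < r) :
    {w : EuclideanSpace ℝ (Fin n) | (w ≠ y ∧ w ≠ z) ∧ seitTwice y z x w < r} =
      {w | dist x w < (Real.exp r - 1) * dist x z / dist y z * dist w y} ∩
        {w | dist x w < (Real.exp r - 1) * dist x y / dist y z * dist w z} := by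
  have hd : 0 < dist y z := dist_pos.mpr hyz
  have key : ∀ q : ℝ, 0 ≤ q → (Real.log (1 + q) < r ↔ q < Real.exp r - 1) := by
    intro q hq
    rw [Real.log_lt_iff_lt_exp (by linarith), lt_sub_iff_add_lt']
  have term : ∀ a b w : EuclideanSpace ℝ (Fin n), x ≠ a → w ≠ b →
      (Real.log (1 + dist y z * dist x w / (dist a x * dist w b)) < r ↔
        dist x w < (Real.exp r - 1) * dist x a / dist y z * dist w b) := by
    intro a b w ha hb
    have ha' : 0 < dist x a := dist_pos.mpr ha
    have hb' : 0 < dist w b := dist_pos.mpr hb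
    rw [dist_comm a x, key _ (by positivity), div_lt_iff₀ (by positivity), div_mul_eq_mul_div,
      lt_div_iff₀ hd, mul_comm (dist y z), mul_assoc (Real.exp r - 1)]
  have hne : ∀ (a w : EuclideanSpace ℝ (Fin n)) (c : ℝ), dist x w < c * dist w a → w ≠ a := by
    rintro a w c h rfl
    simp only [dist_self, mul_zero] at h
    exact dist_nonneg.not_gt h
  ext w
  simp only [Set.mem_ofPred_eq, Set.mem_inter_iff]
  constructor
  · rintro ⟨⟨hwy, hwz⟩, h⟩
    simp only [seitTwice, max_lt_iff, dist_comm z y] at h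
    exact ⟨(term z y w hxz hwy).mp h.2.1, (term y z w hxy hwz).mp h.1.2⟩
  · rintro ⟨h1, h2⟩
    have hwy := hne _ _ _ h1
    have hwz := hne _ _ _ h2
    refine ⟨⟨hwy, hwz⟩, ?_⟩
    simp only [seitTwice, max_lt_iff, dist_comm z y]
    exact ⟨⟨by simpa using hr, (term y z w hxy hwz).mpr h2⟩,
      (term z y w hxz hwy).mpr h1, by simpa using hr⟩

theorem not_convex_seitTwice_ball {n : ℕ} (hn : 2 ≤ n) {x y z : EuclideanSpace ℝ (Fin n)}
    (hyz : y ≠ z) (hxy : x ≠ y) (hxz : x ≠ z) {r : ℝ}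
    (hr : Real.log (1 + dist y z / dist x z) < r) :
    ¬ Convex ℝ {w : EuclideanSpace ℝ (Fin n) |
      (w ≠ y ∧ w ≠ z) ∧ seitTwice y z x w < r} := by
  have hd : 0 < dist y z := dist_pos.mpr hyz
  have hB : 0 < dist x z := dist_pos.mpr hxz
  have hq : 0 < dist y z / dist x z := by positivity
  have hr0 : 0 < r := (Real.log_pos (by linarith)).trans hr
  rw [Real.log_lt_iff_lt_exp (by linarith), ← lt_sub_iff_add_lt', div_lt_iff₀ hB] at hr
  obtain ⟨v, hv, hvxy⟩ := exists_ne_zero_inner_eq_zero_of_two_le hn (y - x)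
  rw [seitTwice_ball_eq hyz hxy hxz hr0]
  exact not_convex_apollonian_inter ((one_lt_div hd).mpr hr) (by ring) hxy hxz hyz hv hvxy

/-- In `G = ℝⁿ \ {y, z}` (`y ≠ z`, `n ≥ 2`), for `x ∈ G` and
`r₁ = log (1 + |y−z| / max (|x−y|, |x−z|))`, the Seittenranta ball `B_δ(x,r)` is
not convex for any `r > r₁`. -/
theorem seittenranta_ball_twice_punctured_not_convex
    (n : ℕ) (hn : 2 ≤ n) (y z : EuclideanSpace ℝ (Fin n)) (hyz : y ≠ z)
    (x : EuclideanSpace ℝ (Fin n)) (hx : x ≠ y ∧ x ≠ z) (r : ℝ)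
    (hr1 : Real.log (1 + dist y z / max (dist x y) (dist x z)) < r) :
    ¬ Convex ℝ {w : EuclideanSpace ℝ (Fin n) |
      (w ≠ y ∧ w ≠ z) ∧ seitTwice y z x w < r} := by
  rcases le_total (dist x y) (dist x z) with h | h
  · rw [max_eq_right h] at hr1
    exact not_convex_seitTwice_ball hn hyz hx.1 hx.2 hr1
  · rw [max_eq_left h, dist_comm y z] at hr1
    simpa only [seitTwice_comm z y, and_comm (a := _ ≠ z)] using
      not_convex_seitTwice_ball hn hyz.symm hx.2 hx.1 hr1
end
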